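/- Let (p,u,U) be a smooth solution of the incompressible Navier-Stokes equations on [0,T_0]×T^3 and let (p',u',U') solve the intermediate affine system on [0,T]×T^3 with T ≤ T_0. Assume there exist constants a ∈ [0,1) and C_0 > 0, independent of ε and δ, such that the initial data satisfy ‖∇²(u'(0,·), √ε p'(0,·), √δ U'(0,·))‖_{L²(T³)} ≤ C_0(ε+δ)^{−a}. Then for all sufficiently small ε+δ and all t ∈ [0,T], ‖Δ(√ε p', u', √δ U')(t,·)‖²_{L²(T³)} ≤ C(ε+δ)^{−2a}, where C depends only on C_0, T_0 and (p,u,U). -/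

import Mathlib

/-!
Common setup: fields on the torus `𝕋^d = ℝ^d/ℤ^d` are modelled as `ℤ^d`-periodic
functions on `ℝ^d`; all integrals are taken over the fundamental cell `[0,1]^d`.
-/

noncomputable section
open MeasureTheory Real
open scoped ENNReal

namespace NSRelax

/-- Spatial variable; fields on the torus are `ℤ^d`-periodic functions on `ℝ^d`. -/
abbrev Spc (d : ℕ) := Fin d → ℝ

/-- Vectors in `ℝ^m`. -/
abbrev Vec (m : ℕ) := Fin m → ℝ

/-- Fundamental cell `[0,1]^d` of the torus. -/
def cube (d : ℕ) : Set (Spc d) := Set.pi Set.univ fun _ => Set.Icc (0 : ℝ) 1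

/-- `ℤ^d`-periodicity. -/
def Per {d : ℕ} {E : Type*} (f : Spc d → E) : Prop :=
  ∀ (x : Spc d) (k : Fin d → ℤ), f (fun i => x i + (k i : ℝ)) = f x

/-- `i`-th spatial partial derivative of a scalar field. -/
def pd {d : ℕ} (i : Fin d) (f : Spc d → ℝ) (x : Spc d) : ℝ :=
  fderiv ℝ f x (Pi.single i 1)

/-- Time derivative of a time-dependent scalar field. -/
def dtS {d : ℕ} (p : ℝ → Spc d → ℝ) (t : ℝ) (x : Spc d) : ℝ :=
  deriv (fun s => p s x) t

/-- Time derivative of a time-dependent vector field. -/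
def dtV {d m : ℕ} (u : ℝ → Spc d → Vec m) (t : ℝ) (x : Spc d) : Vec m :=
  fun a => deriv (fun s => u s x a) t

/-- Time derivative of a time-dependent matrix field. -/
def dtM {d m : ℕ} (U : ℝ → Spc d → Fin m → Fin m → ℝ) (t : ℝ) (x : Spc d) :
    Fin m → Fin m → ℝ :=
  fun i j => deriv (fun s => U s x i j) t

section Norms

variable {d : ℕ} {ι : Type*} [Fintype ι]

/-- Pointwise squared Euclidean magnitude of an `ι`-indexed field. -/
def ptsq (v : Spc d → ι → ℝ) (x : Spc d) : ℝ := ∑ a, v x a ^ 2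

/-- Pointwise squared magnitude of the first derivatives. -/
def ptsqD1 (v : Spc d → ι → ℝ) (x : Spc d) : ℝ :=
  ∑ a, ∑ i, pd i (fun y => v y a) x ^ 2

/-- Pointwise squared magnitude of the second derivatives. -/
def ptsqD2 (v : Spc d → ι → ℝ) (x : Spc d) : ℝ :=
  ∑ a, ∑ i, ∑ j, pd i (pd j (fun y => v y a)) x ^ 2

/-- Pointwise squared magnitude of the third derivatives. -/
def ptsqD3 (v : Spc d → ι → ℝ) (x : Spc d) : ℝ :=
  ∑ a, ∑ i, ∑ j, ∑ k, pd i (pd j (pd k (fun y => v y a))) x ^ 2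

/-- Squared `L²(𝕋^d)` norm. -/
def L2sq (v : Spc d → ι → ℝ) : ℝ := ∫ x in cube d, ptsq v x

/-- Squared `L²(𝕋^d)` norm of the gradient. -/
def D1L2sq (v : Spc d → ι → ℝ) : ℝ := ∫ x in cube d, ptsqD1 v x

/-- Squared `L²(𝕋^d)` norm of the second derivatives. -/
def D2L2sq (v : Spc d → ι → ℝ) : ℝ := ∫ x in cube d, ptsqD2 v x

/-- Squared `L²(𝕋^d)` norm of the third derivatives. -/
def D3L2sq (v : Spc d → ι → ℝ) : ℝ := ∫ x in cube d, ptsqD3 v x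

/-- Squared `H¹(𝕋^d)` norm. -/
def H1sq (v : Spc d → ι → ℝ) : ℝ := L2sq v + D1L2sq v

/-- Squared `H²(𝕋^d)` norm. -/
def H2sq (v : Spc d → ι → ℝ) : ℝ := L2sq v + D1L2sq v + D2L2sq v

/-- Squared `H³(𝕋^d)` norm. -/
def H3sq (v : Spc d → ι → ℝ) : ℝ := L2sq v + D1L2sq v + D2L2sq v + D3L2sq v

/-- `L^p(𝕋^d)` norm. -/
def LpN (p : ℝ) (v : Spc d → ι → ℝ) : ℝ :=
  (∫ x in cube d, Real.sqrt (ptsq v x) ^ p) ^ (1 / p)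

/-- `L^∞(𝕋^d)` norm (for continuous periodic fields). -/
def LinfN (v : Spc d → ι → ℝ) : ℝ := ⨆ x : Spc d, Real.sqrt (ptsq v x)

end Norms

/-- View a scalar field as a one-component indexed field. -/
def sc {d : ℕ} (f : Spc d → ℝ) : Spc d → Vec 1 := fun x _ => f x

/-- View a matrix field as an indexed field. -/
def mtx {d m : ℕ} (U : Spc d → Fin m → Fin m → ℝ) : Spc d → Fin m × Fin m → ℝ :=
  fun x ij => U x ij.1 ij.2

/-- Divergence of a vector field. -/
def divv {d : ℕ} (v : Spc d → Vec d) (x : Spc d) : ℝ := ∑ i, pd i (fun y => v y i) x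

/-- Row-wise divergence of a matrix field. -/
def divM {d : ℕ} (U : Spc d → Fin d → Fin d → ℝ) (x : Spc d) : Vec d :=
  fun i => ∑ j, pd j (fun y => U y i j) x

/-- Laplacian of a scalar field. -/
def lapS {d : ℕ} (f : Spc d → ℝ) (x : Spc d) : ℝ := ∑ i, pd i (pd i f) x

/-- Componentwise Laplacian of a vector field. -/
def lapV {d m : ℕ} (v : Spc d → Vec m) (x : Spc d) : Vec m :=
  fun a => lapS (fun y => v y a) x

/-- Tensor product `u ⊗ v` of vector fields. -/
def tens {d : ℕ} (u v : Spc d → Vec d) (x : Spc d) : Fin d → Fin d → ℝ :=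
  fun i j => u x i * v x j

/-- Curl of a three-dimensional vector field. -/
def curl3 (v : Spc 3 → Vec 3) (x : Spc 3) : Vec 3 :=
  ![pd 1 (fun y => v y 2) x - pd 2 (fun y => v y 1) x,
    pd 2 (fun y => v y 0) x - pd 0 (fun y => v y 2) x,
    pd 0 (fun y => v y 1) x - pd 1 (fun y => v y 0) x]

/-- Scalar curl of a planar vector field. -/
def curl2 (v : Spc 2 → Vec 2) (x : Spc 2) : ℝ :=
  pd 0 (fun y => v y 1) x - pd 1 (fun y => v y 0) x

/-- Smoothness (jointly in time and space) of a scalar field. -/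
def SmoothS {d : ℕ} (p : ℝ → Spc d → ℝ) : Prop :=
  ContDiff ℝ (⊤ : ℕ∞) fun q : ℝ × Spc d => p q.1 q.2

/-- Smoothness (jointly in time and space) of a vector field. -/
def SmoothV {d m : ℕ} (u : ℝ → Spc d → Vec m) : Prop :=
  ContDiff ℝ (⊤ : ℕ∞) fun q : ℝ × Spc d => u q.1 q.2

/-- Smoothness (jointly in time and space) of a matrix field. -/
def SmoothM {d m : ℕ} (U : ℝ → Spc d → Fin m → Fin m → ℝ) : Prop :=
  ContDiff ℝ (⊤ : ℕ∞) fun q : ℝ × Spc d => U q.1 q.2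

/-- Stress tensor `U = u ⊗ u − ∇u` of a Navier–Stokes solution. -/
def stress {d : ℕ} (u : ℝ → Spc d → Vec d) (t : ℝ) (x : Spc d) : Fin d → Fin d → ℝ :=
  fun i j => u t x i * u t x j - pd j (fun y => u t y i) x

/-- Smooth solution of the incompressible Navier–Stokes equations on the time set `I`. -/
structure IsNS (d : ℕ) (I : Set ℝ) (p : ℝ → Spc d → ℝ) (u : ℝ → Spc d → Vec d) :
    Prop where
  smooth_p : SmoothS p
  smooth_u : SmoothV u
  per_p : ∀ t, Per (p t)
  per_u : ∀ t, Per (u t)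
  div_free : ∀ t ∈ I, ∀ x, divv (u t) x = 0
  momentum : ∀ t ∈ I, ∀ x a,
    dtV u t x a + divM (tens (u t) (u t)) x a = -pd a (p t) x + lapV (u t) x a
  mean_zero : ∀ t ∈ I, ∫ x in cube d, p t x = 0

/-- The time interval `[0, Tl)`. -/
def Itv (Tl : ℝ≥0∞) : Set ℝ := {t : ℝ | 0 ≤ t ∧ ENNReal.ofReal t < Tl}

/-- Solution of the two-parameter relaxation system on the time interval `[0, Tl)`,
with smooth initial data. -/
structure IsRelax (d : ℕ) (ε δ : ℝ) (Tl : ℝ≥0∞) (p : ℝ → Spc d → ℝ)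
    (u : ℝ → Spc d → Vec d) (U : ℝ → Spc d → Fin d → Fin d → ℝ) : Prop where
  pos : 0 < Tl
  init_smooth : ContDiff ℝ (⊤ : ℕ∞) fun x : Spc d => (p 0 x, u 0 x, U 0 x)
  per_p : ∀ t ∈ Itv Tl, Per (p t)
  per_u : ∀ t ∈ Itv Tl, Per (u t)
  per_U : ∀ t ∈ Itv Tl, Per (U t)
  cont : ContinuousOn (fun q : ℝ × Spc d => (p q.1 q.2, u q.1 q.2, U q.1 q.2))
    (Itv Tl ×ˢ (Set.univ : Set (Spc d)))
  smooth : ∀ t ∈ Itv Tl, 0 < t → ∀ x : Spc d,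
    ContDiffAt ℝ (⊤ : ℕ∞) (fun q : ℝ × Spc d => (p q.1 q.2, u q.1 q.2, U q.1 q.2)) (t, x)
  mass : ∀ t ∈ Itv Tl, 0 < t → ∀ x, ε * dtS p t x + divv (u t) x = 0
  momentum : ∀ t ∈ Itv Tl, 0 < t → ∀ x a,
    dtV u t x a + divM (U t) x a + pd a (p t) x = 0
  stress_eq : ∀ t ∈ Itv Tl, 0 < t → ∀ x i j,
    δ * dtM U t x i j + pd j (fun y => u t y i) x = u t x i * u t x j - U t x i j

/-- Relaxation solution whose lifespan `Tl` is maximal (among solutions with the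
same initial data). -/
def IsMaxRelax (d : ℕ) (ε δ : ℝ) (Tl : ℝ≥0∞) (p : ℝ → Spc d → ℝ)
    (u : ℝ → Spc d → Vec d) (U : ℝ → Spc d → Fin d → Fin d → ℝ) : Prop :=
  IsRelax d ε δ Tl p u U ∧
    ∀ (Tl' : ℝ≥0∞) (p' : ℝ → Spc d → ℝ) (u' : ℝ → Spc d → Vec d)
      (U' : ℝ → Spc d → Fin d → Fin d → ℝ),
      IsRelax d ε δ Tl' p' u' U' → p' 0 = p 0 → u' 0 = u 0 → U' 0 = U 0 → Tl' ≤ Tl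

/-- Smooth solution of the intermediate affine system on `[0,T]`. -/
structure IsAffine (ε δ T : ℝ) (u : ℝ → Spc 3 → Vec 3) (p' : ℝ → Spc 3 → ℝ)
    (u' : ℝ → Spc 3 → Vec 3) (U' : ℝ → Spc 3 → Fin 3 → Fin 3 → ℝ) : Prop where
  smooth_p : SmoothS p'
  smooth_u : SmoothV u'
  smooth_U : SmoothM U'
  per_p : ∀ t, Per (p' t)
  per_u : ∀ t, Per (u' t)
  per_U : ∀ t, Per (U' t)
  mass : ∀ t ∈ Set.Icc (0 : ℝ) T, ∀ x, ε * dtS p' t x + divv (u' t) x = 0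
  momentum : ∀ t ∈ Set.Icc (0 : ℝ) T, ∀ x a,
    dtV u' t x a + divM (U' t) x a + pd a (p' t) x = 0
  stress_eq : ∀ t ∈ Set.Icc (0 : ℝ) T, ∀ x i j,
    δ * dtM U' t x i j + pd j (fun y => u' t y i) x = u t x i * u t x j - U' t x i j

/-- `A = curl ∇·(v ⊗ v)`. -/
def Af (v : Spc 3 → Vec 3) (x : Spc 3) : Vec 3 :=
  curl3 (fun y => divM (tens v v) y) x

/-- `K = 1 + ‖(p,u,U)‖²_{C⁰H³}`. -/
def Kc (T0 : ℝ) (p : ℝ → Spc 3 → ℝ) (u : ℝ → Spc 3 → Vec 3) : ℝ :=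
  1 + ⨆ t ∈ Set.Icc (0 : ℝ) T0, (H3sq (sc (p t)) + H3sq (u t) + H3sq (mtx (stress u t)))

/-- `K = 1 + ‖u‖²_{C⁰H³}`. -/
def Ku (T0 : ℝ) (u : ℝ → Spc 3 → Vec 3) : ℝ :=
  1 + ⨆ t ∈ Set.Icc (0 : ℝ) T0, H3sq (u t)

section Calculus

variable {d : ℕ} {f g : Spc d → ℝ}

theorem pd_smooth (hf : ContDiff ℝ (⊤ : ℕ∞) f) (i : Fin d) : ContDiff ℝ (⊤ : ℕ∞) (pd i f) :=
  (hf.fderiv_right (m := (⊤ : ℕ∞)) (by simp)).clm_apply contDiff_const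

theorem pd_add (hf : ContDiff ℝ (⊤ : ℕ∞) f) (hg : ContDiff ℝ (⊤ : ℕ∞) g) (i : Fin d) :
    pd i (fun x => f x + g x) = fun x => pd i f x + pd i g x := by
  ext x
  simp only [pd]
  rw [fderiv_fun_add (hf.differentiable (by simp) x) (hg.differentiable (by simp) x)]
  rfl

theorem pd_const_mul (hf : ContDiff ℝ (⊤ : ℕ∞) f) (c : ℝ) (i : Fin d) :
    pd i (fun x => c * f x) = fun x => c * pd i f x := by
  ext x
  simp only [pd]
  rw [fderiv_const_mul (hf.differentiable (by simp) x)]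
  rfl

theorem pd_mul (hf : ContDiff ℝ (⊤ : ℕ∞) f) (hg : ContDiff ℝ (⊤ : ℕ∞) g) (i : Fin d) :
    pd i (fun x => f x * g x) = fun x => f x * pd i g x + g x * pd i f x := by
  ext x
  simp only [pd]
  rw [fderiv_fun_mul (hf.differentiable (by simp) x) (hg.differentiable (by simp) x)]
  rfl

theorem pd_sum {κ : Type*} (s : Finset κ) {F : κ → Spc d → ℝ}
    (hF : ∀ k, ContDiff ℝ (⊤ : ℕ∞) (F k)) (i : Fin d) :
    pd i (fun x => ∑ k ∈ s, F k x) = fun x => ∑ k ∈ s, pd i (F k) x := by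
  ext x
  simp only [pd]
  rw [fderiv_fun_sum fun k _ => (hF k).differentiable (by simp) x]
  simp

theorem fderiv_fderiv_apply_comm {E : Type*} [NormedAddCommGroup E] [NormedSpace ℝ E] {F : E → ℝ}
    (hF : ContDiff ℝ (⊤ : ℕ∞) F) (v w x : E) :
    fderiv ℝ (fun y => fderiv ℝ F y v) x w = fderiv ℝ (fun y => fderiv ℝ F y w) x v := by
  have hd : DifferentiableAt ℝ (fderiv ℝ F) x :=
    (hF.fderiv_right (m := (⊤ : ℕ∞)) (by simp)).differentiable (by simp) x
  have key : ∀ z : E, fderiv ℝ (fun y => fderiv ℝ F y z) x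
      = (fderiv ℝ (fderiv ℝ F) x).flip z := fun z => by
    rw [fderiv_clm_apply hd (differentiableAt_const z)]
    simp
  rw [key, key]
  exact (hF.contDiffAt.isSymmSndFDerivAt
    (by rw [minSmoothness_of_isRCLikeNormedField]; exact WithTop.coe_le_coe.2 le_top)) w v

theorem pd_comm (hf : ContDiff ℝ (⊤ : ℕ∞) f) (i j : Fin d) : pd i (pd j f) = pd j (pd i f) := by
  ext x
  exact fderiv_fderiv_apply_comm hf _ _ x

theorem lapS_smooth (hf : ContDiff ℝ (⊤ : ℕ∞) f) : ContDiff ℝ (⊤ : ℕ∞) (lapS f) :=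
  ContDiff.sum fun i _ => pd_smooth (pd_smooth hf i) i

@[simp]
theorem lapS_zero : lapS (fun _ : Spc d => 0) = fun _ => 0 := by
  have h : ∀ i : Fin d, pd i (fun _ => 0) = fun _ => 0 := fun i => by
    ext x
    simp [pd]
  ext x
  simp [lapS, h]

theorem lapS_add (hf : ContDiff ℝ (⊤ : ℕ∞) f) (hg : ContDiff ℝ (⊤ : ℕ∞) g) :
    lapS (fun x => f x + g x) = fun x => lapS f x + lapS g x := by
  ext x
  simp only [lapS, pd_add hf hg, pd_add (pd_smooth hf _) (pd_smooth hg _),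
    Finset.sum_add_distrib]

theorem lapS_const_mul (hf : ContDiff ℝ (⊤ : ℕ∞) f) (c : ℝ) :
    lapS (fun x => c * f x) = fun x => c * lapS f x := by
  ext x
  simp only [lapS, pd_const_mul hf, pd_const_mul (pd_smooth hf _), Finset.mul_sum]

theorem lapS_sum {κ : Type*} (s : Finset κ) {F : κ → Spc d → ℝ}
    (hF : ∀ k, ContDiff ℝ (⊤ : ℕ∞) (F k)) :
    lapS (fun x => ∑ k ∈ s, F k x) = fun x => ∑ k ∈ s, lapS (F k) x := by
  ext x
  simp only [lapS, pd_sum s hF, pd_sum s fun k => pd_smooth (hF k) _]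
  exact Finset.sum_comm

theorem lapS_pd (hf : ContDiff ℝ (⊤ : ℕ∞) f) (i : Fin d) : lapS (pd i f) = pd i (lapS f) := by
  ext x
  have h : lapS f = fun x => ∑ j, pd j (pd j f) x := rfl
  rw [h, pd_sum _ fun j => pd_smooth (pd_smooth hf j) j]
  refine Finset.sum_congr rfl fun j _ => ?_
  rw [pd_comm hf j i, pd_comm (pd_smooth hf j) i j]

theorem Per.pd (hf : Per f) (i : Fin d) : Per (pd i f) := by
  intro x k
  have h : (fun y => f (y + fun i => (k i : ℝ))) = f := funext fun y => hf y k
  have := fderiv_comp_add_right (𝕜 := ℝ) (f := f) (x := x) (fun i => (k i : ℝ))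
  rw [h] at this
  simp only [NSRelax.pd]
  rw [this]
  rfl

theorem Per.lapS (hf : Per f) : Per (lapS f) := by
  intro x k
  exact Finset.sum_congr rfl fun i _ => (hf.pd i).pd i x k

theorem lapS_sq_le (f : Spc d → ℝ) (x : Spc d) :
    lapS f x ^ 2 ≤ d * ∑ i, ∑ j, pd i (pd j f) x ^ 2 := by
  refine (sq_sum_le_card_mul_sum_sq (s := Finset.univ)).trans ?_
  simp only [Finset.card_univ, Fintype.card_fin]
  gcongr with i
  exact Finset.single_le_sum (f := fun j => NSRelax.pd i (NSRelax.pd j f) x ^ 2)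
    (fun j _ => sq_nonneg _) (Finset.mem_univ i)

end Calculus

section TimeDependent

variable {d : ℕ} {f : ℝ → Spc d → ℝ}

theorem SmoothS.slice (hf : SmoothS f) (t : ℝ) : ContDiff ℝ (⊤ : ℕ∞) (f t) :=
  ContDiff.comp (g := fun q : ℝ × Spc d => f q.1 q.2) hf (contDiff_const.prodMk contDiff_id)

theorem SmoothS.pd_eq (hf : SmoothS f) (i : Fin d) (t : ℝ) (x : Spc d) :
    pd i (f t) x = fderiv ℝ (fun q : ℝ × Spc d => f q.1 q.2) (t, x) (0, Pi.single i 1) := by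
  have h1 : HasFDerivAt (fun y : Spc d => (t, y)) (ContinuousLinearMap.inr ℝ ℝ (Spc d)) x :=
    (hasFDerivAt_const t x).prodMk (hasFDerivAt_id x)
  have h2 := (ContDiff.differentiable hf (by simp) (t, x)).hasFDerivAt.comp x h1
  simp only [pd]
  rw [show f t = (fun q : ℝ × Spc d => f q.1 q.2) ∘ (fun y => (t, y)) from rfl, h2.fderiv]
  rfl

theorem SmoothS.hasDerivAt (hf : SmoothS f) (t : ℝ) (x : Spc d) :
    HasDerivAt (fun s => f s x) (dtS f t x) t := by
  have h : ContDiff ℝ (⊤ : ℕ∞) fun s => f s x :=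
    ContDiff.comp (g := fun q : ℝ × Spc d => f q.1 q.2) hf (contDiff_id.prodMk contDiff_const)
  exact (h.differentiable (by simp) t).hasDerivAt

theorem SmoothS.dtS_eq (hf : SmoothS f) (t : ℝ) (x : Spc d) :
    dtS f t x = fderiv ℝ (fun q : ℝ × Spc d => f q.1 q.2) (t, x) (1, 0) := by
  have h1 : HasDerivAt (fun s : ℝ => (s, x)) ((1 : ℝ), (0 : Spc d)) t :=
    (hasDerivAt_id t).prodMk (hasDerivAt_const t x)
  have h2 := (ContDiff.differentiable hf (by simp) (t, x)).hasFDerivAt.comp_hasDerivAt t h1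
  exact h2.deriv

theorem SmoothS.pd (hf : SmoothS f) (i : Fin d) : SmoothS fun t => pd i (f t) := by
  unfold SmoothS
  simp only [hf.pd_eq]
  exact (ContDiff.fderiv_right (m := (⊤ : ℕ∞)) hf (by simp)).clm_apply contDiff_const

theorem SmoothS.dtS (hf : SmoothS f) : SmoothS (dtS f) := by
  unfold SmoothS
  simp only [hf.dtS_eq]
  exact (ContDiff.fderiv_right (m := (⊤ : ℕ∞)) hf (by simp)).clm_apply contDiff_const

theorem SmoothS.sum {κ : Type*} {s : Finset κ} {F : κ → ℝ → Spc d → ℝ}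
    (hF : ∀ k, SmoothS (F k)) : SmoothS fun t x => ∑ k ∈ s, F k t x :=
  ContDiff.sum fun k _ => hF k

theorem SmoothS.sq (hf : SmoothS f) : SmoothS fun t x => f t x ^ 2 :=
  ContDiff.pow hf 2

theorem SmoothS.lapS (hf : SmoothS f) : SmoothS fun t => lapS (f t) :=
  SmoothS.sum fun i => (hf.pd i).pd i

theorem SmoothS.dtS_pd (hf : SmoothS f) (i : Fin d) (t : ℝ) :
    NSRelax.dtS (fun t => NSRelax.pd i (f t)) t = NSRelax.pd i (NSRelax.dtS f t) := by
  ext x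
  rw [(hf.pd i).dtS_eq, hf.dtS.pd_eq]
  simp only [hf.pd_eq, hf.dtS_eq]
  exact fderiv_fderiv_apply_comm hf _ _ _

theorem SmoothS.dtS_lapS (hf : SmoothS f) (t : ℝ) :
    NSRelax.dtS (fun t => NSRelax.lapS (f t)) t = NSRelax.lapS (NSRelax.dtS f t) := by
  ext x
  have h : HasDerivAt (fun s => NSRelax.lapS (f s) x)
      (∑ i, NSRelax.dtS (fun t => NSRelax.pd i (NSRelax.pd i (f t))) t x) t :=
    HasDerivAt.fun_sum fun i _ => ((hf.pd i).pd i).hasDerivAt t x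
  refine h.deriv.trans (Finset.sum_congr rfl fun i _ => ?_)
  rw [(hf.pd i).dtS_pd, hf.dtS_pd]

end TimeDependent

section Integration

theorem cube_eq_Icc (d : ℕ) : cube d = Set.Icc 0 1 := Set.pi_univ_Icc _ _

theorem isCompact_cube (d : ℕ) : IsCompact (cube d) := cube_eq_Icc d ▸ isCompact_Icc

theorem measurableSet_cube (d : ℕ) : MeasurableSet (cube d) := (isCompact_cube d).measurableSet

theorem volume_real_cube (d : ℕ) : volume.real (cube d) = 1 := by
  rw [cube_eq_Icc, Measure.real, Real.volume_Icc_pi_toReal zero_le_one]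
  simp

theorem Continuous.integrableOn_cube {d : ℕ} {f : Spc d → ℝ} (hf : Continuous f) :
    IntegrableOn f (cube d) :=
  hf.continuousOn.integrableOn_compact (isCompact_cube d)

theorem integral_cube_divv_eq_zero {n : ℕ} {v : Spc (n + 1) → Vec (n + 1)}
    (hv : ∀ i, ContDiff ℝ (⊤ : ℕ∞) fun x => v x i) (hper : ∀ i, Per fun x => v x i) :
    ∫ x in cube (n + 1), divv v x = 0 := by
  have hv' : ContDiff ℝ (⊤ : ℕ∞) v := contDiff_pi.2 hv
  have hpd : ∀ x i, fderiv ℝ v x (Pi.single i 1) i = pd i (fun y => v y i) x := fun x i => by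
    have := fderiv_pi (𝕜 := ℝ) (φ := fun i y => v y i) (x := x)
      fun i => (hv i).differentiable (by simp) x
    rw [show v = fun y i => v y i from rfl, this]
    rfl
  have hint : IntegrableOn (fun x => ∑ i, fderiv ℝ v x (Pi.single i 1) i)
      (Set.Icc (0 : Spc (n + 1)) 1) := by
    simp only [hpd]
    rw [← cube_eq_Icc]
    exact Continuous.integrableOn_cube
      (continuous_finsetSum _ fun i _ => (pd_smooth (hv i) i).continuous)
  have key := integral_divergence_of_hasFDerivAt_off_countable (0 : Spc (n + 1)) 1 zero_le_one
    v (fderiv ℝ v) ∅ Set.countable_empty hv'.continuous.continuousOn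
    (fun x _ => (hv'.differentiable (by simp) x).hasFDerivAt) hint
  simp only [hpd] at key
  rw [cube_eq_Icc]
  refine key.trans (Finset.sum_eq_zero fun i _ => sub_eq_zero.2 ?_)
  congr 1
  ext x
  refine Eq.trans (congrArg (fun y => v y i) ?_) (hper i _ (Pi.single i 1))
  ext j
  rcases eq_or_ne j i with rfl | hj
  · simp
  · obtain ⟨k, rfl⟩ := Fin.exists_succAbove_eq hj
    simp

theorem integral_cube_le_add_mul {d : ℕ} {e : ℝ → Spc d → ℝ} (he : SmoothS e) {T M : ℝ}
    (hM : ∀ s ∈ Set.Icc 0 T, ∫ x in cube d, dtS e s x ≤ M) {t : ℝ} (ht : t ∈ Set.Icc 0 T) :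
    ∫ x in cube d, e t x ≤ (∫ x in cube d, e 0 x) + M * t := by
  have hc : Continuous fun q : ℝ × Spc d => dtS e q.1 q.2 := ContDiff.continuous he.dtS
  have hftc : ∀ x, ∫ s in (0 : ℝ)..t, dtS e s x = e t x - e 0 x := fun x =>
    intervalIntegral.integral_eq_sub_of_hasDerivAt (fun s _ => he.hasDerivAt s x)
      ((hc.comp (by fun_prop : Continuous fun s : ℝ => (s, x))).intervalIntegrable _ _)
  have hprod : Integrable (Function.uncurry fun s x => dtS e s x)
      ((volume.restrict (Set.uIoc 0 t)).prod (volume.restrict (cube d))) := by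
    rw [Measure.prod_restrict]
    refine IntegrableOn.mono_set (t := Set.Icc 0 t ×ˢ cube d) ?_ ?_
    · exact ContinuousOn.integrableOn_compact (isCompact_Icc.prod (isCompact_cube d))
        hc.continuousOn
    · rw [Set.uIoc_of_le ht.1]
      exact Set.prod_mono Set.Ioc_subset_Icc_self subset_rfl
  have hswap := intervalIntegral_integral_swap hprod
  simp only [hftc] at hswap
  rw [integral_sub (Continuous.integrableOn_cube (he.slice t).continuous)
    (Continuous.integrableOn_cube (he.slice 0).continuous)] at hswap
  have hle : ∫ s in (0 : ℝ)..t, ∫ x in cube d, dtS e s x ≤ ∫ _ in (0 : ℝ)..t, M := by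
    refine intervalIntegral.integral_mono_on ht.1 ?_ (by simp)
      fun s hs => hM s ⟨hs.1, hs.2.trans ht.2⟩
    rw [intervalIntegrable_iff]
    exact hprod.integral_prod_left
  simp only [intervalIntegral.integral_const, sub_zero, smul_eq_mul] at hle
  linarith [mul_comm t M]

end Integration

section Energy

variable {ε δ T : ℝ} {u : ℝ → Spc 3 → Vec 3} {p' : ℝ → Spc 3 → ℝ}
  {u' : ℝ → Spc 3 → Vec 3} {U' : ℝ → Spc 3 → Fin 3 → Fin 3 → ℝ}

theorem SmoothV.comp {d m : ℕ} {u : ℝ → Spc d → Vec m} (hu : SmoothV u) (i : Fin m) :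
    SmoothS fun t x => u t x i :=
  contDiff_pi.1 hu i

theorem SmoothM.comp {d m : ℕ} {U : ℝ → Spc d → Fin m → Fin m → ℝ} (hU : SmoothM U)
    (i j : Fin m) : SmoothS fun t x => U t x i j :=
  contDiff_pi.1 (contDiff_pi.1 hU i) j

/-- Density of the energy `ε |Δp'|² + |Δu'|² + δ |ΔU'|²`. -/
def energyDensity (ε δ : ℝ) (p' : ℝ → Spc 3 → ℝ) (u' : ℝ → Spc 3 → Vec 3)
    (U' : ℝ → Spc 3 → Fin 3 → Fin 3 → ℝ) (t : ℝ) (x : Spc 3) : ℝ :=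
  ε * lapS (p' t) x ^ 2 + ∑ i, lapS (fun y => u' t y i) x ^ 2
    + δ * ∑ i, ∑ j, lapS (fun y => U' t y i j) x ^ 2

/-- Squared magnitude of `Δ(u ⊗ u)`. -/
def forcingSq (u : ℝ → Spc 3 → Vec 3) (t : ℝ) (x : Spc 3) : ℝ :=
  ∑ i, ∑ j, lapS (fun y => u t y i * u t y j) x ^ 2

/-- Flux `Δp' Δu' + (ΔU')ᵀ Δu'` of the energy. -/
def energyFlux (p' : ℝ → Spc 3 → ℝ) (u' : ℝ → Spc 3 → Vec 3)
    (U' : ℝ → Spc 3 → Fin 3 → Fin 3 → ℝ) (t : ℝ) (x : Spc 3) : Vec 3 :=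
  fun j => lapS (p' t) x * lapS (fun y => u' t y j) x
    + ∑ i, lapS (fun y => u' t y i) x * lapS (fun y => U' t y i j) x

theorem forcingSq_smooth (hu : SmoothV u) : SmoothS (forcingSq u) :=
  SmoothS.sum fun i => SmoothS.sum fun j =>
    (SmoothS.lapS (f := fun t x => u t x i * u t x j)
      (ContDiff.mul (hu.comp i) (hu.comp j))).sq

theorem IsAffine.energyDensity_smooth (h : IsAffine ε δ T u p' u' U') :
    SmoothS (energyDensity ε δ p' u' U') :=
  ContDiff.add (ContDiff.add
    (contDiff_const.mul h.smooth_p.lapS.sq)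
    (SmoothS.sum fun i => (h.smooth_u.comp i).lapS.sq))
    (contDiff_const.mul (SmoothS.sum fun i => SmoothS.sum fun j =>
      (h.smooth_U.comp i j).lapS.sq))

theorem IsAffine.lapS_mass (h : IsAffine ε δ T u p' u' U') {t : ℝ} (ht : t ∈ Set.Icc 0 T)
    (x : Spc 3) :
    ε * dtS (fun t => lapS (p' t)) t x + ∑ i, pd i (lapS fun y => u' t y i) x = 0 := by
  have hs := fun i => (h.smooth_u.comp i).slice t
  have h0 : lapS (fun x => ε * dtS p' t x + ∑ i, pd i (fun y => u' t y i) x) x = 0 := by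
    rw [show (fun x => ε * dtS p' t x + ∑ i, pd i (fun y => u' t y i) x) = fun _ => 0 from
      funext (h.mass t ht)]
    simp
  rw [lapS_add (contDiff_const.mul (h.smooth_p.dtS.slice t))
    (ContDiff.sum fun i _ => pd_smooth (hs i) i), lapS_const_mul (h.smooth_p.dtS.slice t),
    lapS_sum _ fun i => pd_smooth (hs i) i] at h0
  rw [h.smooth_p.dtS_lapS]
  simpa only [lapS_pd (hs _)] using h0

theorem IsAffine.lapS_momentum (h : IsAffine ε δ T u p' u' U') {t : ℝ} (ht : t ∈ Set.Icc 0 T)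
    (x : Spc 3) (i : Fin 3) :
    dtS (fun t => lapS fun y => u' t y i) t x + ∑ j, pd j (lapS fun y => U' t y i j) x
      + pd i (lapS (p' t)) x = 0 := by
  have hs := fun j => (h.smooth_U.comp i j).slice t
  have hut := (h.smooth_u.comp i).dtS.slice t
  have hp := h.smooth_p.slice t
  have hdiv := ContDiff.sum (s := Finset.univ) fun j _ => pd_smooth (hs j) j
  have h0 : lapS (fun x => dtS (fun t x => u' t x i) t x
      + ∑ j, pd j (fun y => U' t y i j) x + pd i (p' t) x) x = 0 := by
    rw [show (fun x => dtS (fun t x => u' t x i) t x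
      + ∑ j, pd j (fun y => U' t y i j) x + pd i (p' t) x) = fun _ => 0 from
      funext fun x => h.momentum t ht x i]
    simp
  rw [lapS_add (hut.add hdiv) (pd_smooth hp i), lapS_add hut hdiv,
    lapS_sum _ fun j => pd_smooth (hs j) j] at h0
  rw [(h.smooth_u.comp i).dtS_lapS]
  simpa only [lapS_pd (hs _), lapS_pd hp] using h0

theorem IsAffine.lapS_stress (h : IsAffine ε δ T u p' u' U') (hu : SmoothV u) {t : ℝ}
    (ht : t ∈ Set.Icc 0 T) (x : Spc 3) (i j : Fin 3) :
    δ * dtS (fun t => lapS fun y => U' t y i j) t x + pd j (lapS fun y => u' t y i) x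
      = lapS (fun y => u t y i * u t y j) x - lapS (fun y => U' t y i j) x := by
  have hU := (h.smooth_U.comp i j).slice t
  have hUt := (h.smooth_U.comp i j).dtS.slice t
  have hu' := (h.smooth_u.comp i).slice t
  have huu := ((hu.comp i).slice t).mul ((hu.comp j).slice t)
  have h0 : lapS (fun x => δ * dtS (fun t x => U' t x i j) t x + pd j (fun y => u' t y i) x
      + U' t x i j) x = lapS (fun x => u t x i * u t x j) x := by
    congr 1
    ext x
    have := h.stress_eq t ht x i j
    simp only [dtM, dtS] at this ⊢
    linarith
  rw [lapS_add ((contDiff_const.mul hUt).add (pd_smooth hu' j)) hU,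
    lapS_add (contDiff_const.mul hUt) (pd_smooth hu' j), lapS_const_mul hUt, lapS_pd hu'] at h0
  rw [(h.smooth_U.comp i j).dtS_lapS]
  linarith

theorem IsAffine.dtS_energyDensity_le (h : IsAffine ε δ T u p' u' U') (hu : SmoothV u) {t : ℝ}
    (ht : t ∈ Set.Icc 0 T) (x : Spc 3) :
    dtS (energyDensity ε δ p' u' U') t x
      ≤ forcingSq u t x - 2 * divv (energyFlux p' u' U' t) x := by
  have hp := lapS_smooth (h.smooth_p.slice t)
  have hv := fun i => lapS_smooth ((h.smooth_u.comp i).slice t)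
  have hU := fun i j => lapS_smooth ((h.smooth_U.comp i j).slice t)
  have hder : dtS (energyDensity ε δ p' u' U') t x
      = 2 * (lapS (p' t) x * (ε * dtS (fun t => lapS (p' t)) t x)
        + ∑ i, lapS (fun y => u' t y i) x * dtS (fun t => lapS fun y => u' t y i) t x
        + ∑ i, ∑ j, lapS (fun y => U' t y i j) x
          * (δ * dtS (fun t => lapS fun y => U' t y i j) t x)) := by
    have hd := (((h.smooth_p.lapS.hasDerivAt t x).pow 2).const_mul ε).add
      (HasDerivAt.fun_sum (u := Finset.univ) fun i _ =>
        ((h.smooth_u.comp i).lapS.hasDerivAt t x).pow 2)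
    have hd := hd.add ((HasDerivAt.fun_sum (u := Finset.univ) fun i _ =>
      HasDerivAt.fun_sum (u := Finset.univ) fun j _ =>
        ((h.smooth_U.comp i j).lapS.hasDerivAt t x).pow 2).const_mul δ)
    refine hd.deriv.trans ?_
    simp only [Fin.sum_univ_three]
    push_cast
    ring
  have hdiv : divv (energyFlux p' u' U' t) x
      = ∑ j, (lapS (p' t) x * pd j (lapS fun y => u' t y j) x
          + lapS (fun y => u' t y j) x * pd j (lapS (p' t)) x)
        + ∑ j, ∑ i, (lapS (fun y => u' t y i) x * pd j (lapS fun y => U' t y i j) x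
          + lapS (fun y => U' t y i j) x * pd j (lapS fun y => u' t y i) x) := by
    simp only [divv, energyFlux, ← Finset.sum_add_distrib]
    refine Finset.sum_congr rfl fun j _ => ?_
    rw [pd_add (hp.mul (hv j)) (ContDiff.sum fun i _ => (hv i).mul (hU i j)),
      pd_mul hp (hv j), pd_sum _ fun i => (hv i).mul (hU i j)]
    simp only [pd_mul (hv _) (hU _ _)]
  have hmass : ε * dtS (fun t => lapS (p' t)) t x = -∑ i, pd i (lapS fun y => u' t y i) x := by
    linarith [h.lapS_mass ht x]
  have hmom : ∀ i, dtS (fun t => lapS fun y => u' t y i) t x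
      = -∑ j, pd j (lapS fun y => U' t y i j) x - pd i (lapS (p' t)) x := fun i => by
    linarith [h.lapS_momentum ht x i]
  have hstr : ∀ i j, δ * dtS (fun t => lapS fun y => U' t y i j) t x
      = lapS (fun y => u t y i * u t y j) x - lapS (fun y => U' t y i j) x
        - pd j (lapS fun y => u' t y i) x := fun i j => by
    linarith [h.lapS_stress hu ht x i j]
  have hsplit : dtS (energyDensity ε δ p' u' U') t x + 2 * divv (energyFlux p' u' U' t) x
      = ∑ i, ∑ j, 2 * (lapS (fun y => U' t y i j) x
        * (lapS (fun y => u t y i * u t y j) x - lapS (fun y => U' t y i j) x)) := by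
    rw [hder, hdiv, hmass]
    simp only [hmom, hstr, Fin.sum_univ_three]
    ring
  have hle : ∑ i, ∑ j, 2 * (lapS (fun y => U' t y i j) x
        * (lapS (fun y => u t y i * u t y j) x - lapS (fun y => U' t y i j) x))
      ≤ forcingSq u t x := by
    refine Finset.sum_le_sum fun i _ => Finset.sum_le_sum fun j _ => ?_
    nlinarith [sq_nonneg (lapS (fun y => U' t y i j) x - lapS (fun y => u t y i * u t y j) x),
      sq_nonneg (lapS (fun y => U' t y i j) x)]
  linarith

theorem IsAffine.integral_dtS_energyDensity_le (h : IsAffine ε δ T u p' u' U')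
    (hu : SmoothV u) {t : ℝ} (ht : t ∈ Set.Icc 0 T) :
    ∫ x in cube 3, dtS (energyDensity ε δ p' u' U') t x ≤ ∫ x in cube 3, forcingSq u t x := by
  have hp := lapS_smooth (h.smooth_p.slice t)
  have hv := fun i => lapS_smooth ((h.smooth_u.comp i).slice t)
  have hU := fun i j => lapS_smooth ((h.smooth_U.comp i j).slice t)
  have hflux : ∀ j, ContDiff ℝ (⊤ : ℕ∞) fun x => energyFlux p' u' U' t x j := fun j =>
    (hp.mul (hv j)).add (ContDiff.sum fun i _ => (hv i).mul (hU i j))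
  have hper : ∀ j, Per fun x => energyFlux p' u' U' t x j := fun j x k => by
    have hp := (h.per_p t).lapS x k
    have hv := fun i => Per.lapS (f := fun y => u' t y i)
      (fun x k => congrFun (h.per_u t x k) i) x k
    have hU := fun i => Per.lapS (f := fun y => U' t y i j)
      (fun x k => congrFun (congrFun (h.per_U t x k) i) j) x k
    simp only [energyFlux, hp, hv, hU]
  have hdivv : Continuous (divv (energyFlux p' u' U' t)) :=
    continuous_finsetSum _ fun j _ => (pd_smooth (hflux j) j).continuous
  have hdivv2 : Continuous fun x => 2 * divv (energyFlux p' u' U' t) x :=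
    continuous_const.mul hdivv
  have hforce := ((forcingSq_smooth hu).slice t).continuous
  calc ∫ x in cube 3, dtS (energyDensity ε δ p' u' U') t x
      ≤ ∫ x in cube 3, (forcingSq u t x - 2 * divv (energyFlux p' u' U' t) x) :=
        setIntegral_mono
          (Continuous.integrableOn_cube (h.energyDensity_smooth.dtS.slice t).continuous)
          (Continuous.integrableOn_cube (hforce.sub hdivv2))
          fun x => h.dtS_energyDensity_le hu ht x
    _ = ∫ x in cube 3, forcingSq u t x := by
        rw [integral_sub (Continuous.integrableOn_cube hforce)
          (Continuous.integrableOn_cube hdivv2), integral_const_mul,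
          integral_cube_divv_eq_zero hflux hper, mul_zero, sub_zero]

theorem exists_integral_forcingSq_le (hu : SmoothV u) (T : ℝ) :
    ∃ M, 0 ≤ M ∧ ∀ t ∈ Set.Icc 0 T, ∫ x in cube 3, forcingSq u t x ≤ M := by
  have hc := ContDiff.continuous (forcingSq_smooth hu)
  obtain ⟨M, hM⟩ := ((isCompact_Icc (a := 0) (b := T)).prod (isCompact_cube 3)).bddAbove_image
    hc.continuousOn
  refine ⟨max M 0, le_max_right _ _, fun t ht => ?_⟩
  calc ∫ x in cube 3, forcingSq u t x ≤ ∫ _ in cube 3, max M 0 :=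
        setIntegral_mono_on
          (Continuous.integrableOn_cube ((forcingSq_smooth hu).slice t).continuous)
          (Continuous.integrableOn_cube continuous_const) (measurableSet_cube 3)
          fun x hx => (hM ⟨(t, x), ⟨ht, hx⟩, rfl⟩).trans (le_max_left _ _)
    _ = max M 0 := by simp [volume_real_cube]

theorem IsAffine.integral_energyDensity_eq (h : IsAffine ε δ T u p' u' U') (t : ℝ) :
    ∫ x in cube 3, energyDensity ε δ p' u' U' t x
      = ε * L2sq (sc fun x => lapS (p' t) x) + L2sq (fun x => lapV (u' t) x)
        + δ * L2sq (mtx fun x i j => lapS (fun y => U' t y i j) x) := by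
  have hp := (lapS_smooth (h.smooth_p.slice t)).continuous
  have hv := fun i => (lapS_smooth ((h.smooth_u.comp i).slice t)).continuous
  have hU := fun i j => (lapS_smooth ((h.smooth_U.comp i j).slice t)).continuous
  have hv2 : Continuous fun x => ∑ i, lapS (fun y => u' t y i) x ^ 2 :=
    continuous_finsetSum _ fun i _ => (hv i).pow 2
  have hU2 : Continuous fun x => ∑ i, ∑ j, lapS (fun y => U' t y i j) x ^ 2 :=
    continuous_finsetSum _ fun i _ => continuous_finsetSum _ fun j _ => (hU i j).pow 2
  have hp2 : Continuous fun x => ε * lapS (p' t) x ^ 2 := continuous_const.mul (hp.pow 2)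
  have hδU2 : Continuous fun x => δ * ∑ i, ∑ j, lapS (fun y => U' t y i j) x ^ 2 :=
    continuous_const.mul hU2
  simp only [energyDensity, L2sq, ptsq, sc, mtx, lapV, Fintype.sum_prod_type,
    Finset.univ_unique, Finset.sum_singleton]
  rw [integral_add ((Continuous.integrableOn_cube hp2).fun_add
      (Continuous.integrableOn_cube hv2)) (Continuous.integrableOn_cube hδU2),
    integral_add (Continuous.integrableOn_cube hp2) (Continuous.integrableOn_cube hv2),
    integral_const_mul, integral_const_mul]

theorem L2sq_lapS_le {d : ℕ} {ι : Type*} [Fintype ι] {v : Spc d → ι → ℝ}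
    (hv : ∀ a, ContDiff ℝ (⊤ : ℕ∞) fun x => v x a) :
    L2sq (fun x a => lapS (fun y => v y a) x) ≤ d * D2L2sq v := by
  rw [L2sq, D2L2sq, ← integral_const_mul]
  refine setIntegral_mono (Continuous.integrableOn_cube ?_) (Continuous.integrableOn_cube ?_)
    fun x => ?_
  · exact continuous_finsetSum _ fun a _ => (lapS_smooth (hv a)).continuous.pow 2
  · exact continuous_const.mul <| continuous_finsetSum _ fun a _ =>
      continuous_finsetSum _ fun i _ => continuous_finsetSum _ fun j _ =>
        (pd_smooth (pd_smooth (hv a) j) i).continuous.pow 2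
  · simp only [ptsq, ptsqD2]
    rw [Finset.mul_sum]
    exact Finset.sum_le_sum fun a _ => lapS_sq_le _ x

theorem IsAffine.integral_energyDensity_le (h : IsAffine ε δ T u p' u' U') (hε : 0 ≤ ε)
    (hδ : 0 ≤ δ) (t : ℝ) :
    ∫ x in cube 3, energyDensity ε δ p' u' U' t x
      ≤ 3 * (D2L2sq (u' t) + ε * D2L2sq (sc (p' t)) + δ * D2L2sq (mtx (U' t))) := by
  rw [h.integral_energyDensity_eq]
  have hp := mul_le_mul_of_nonneg_left
    (L2sq_lapS_le (v := sc (p' t)) fun _ => h.smooth_p.slice t) hε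
  have hv := L2sq_lapS_le (v := u' t) fun i => (h.smooth_u.comp i).slice t
  have hU := mul_le_mul_of_nonneg_left
    (L2sq_lapS_le (v := mtx (U' t)) fun ij => (h.smooth_U.comp ij.1 ij.2).slice t) hδ
  push_cast at hp hv hU
  calc _ ≤ ε * (3 * D2L2sq (sc (p' t))) + 3 * D2L2sq (u' t)
        + δ * (3 * D2L2sq (mtx (U' t))) := add_le_add (add_le_add hp hv) hU
    _ = _ := by ring

end Energy

/-- estimate (3.13) of the paper: uniform `H²`-type bound for the
solution of the intermediate affine system. -/
theorem affine_H2_bound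
    (T0 T : ℝ) (hT0 : 0 < T0) (hT : 0 < T) (hTT0 : T ≤ T0)
    (p : ℝ → Spc 3 → ℝ) (u : ℝ → Spc 3 → Vec 3)
    (hNS : IsNS 3 (Set.Icc 0 T0) p u)
    (pa : ℝ → ℝ → ℝ → Spc 3 → ℝ) (ua : ℝ → ℝ → ℝ → Spc 3 → Vec 3)
    (Ua : ℝ → ℝ → ℝ → Spc 3 → Fin 3 → Fin 3 → ℝ)
    (hAff : ∀ ε δ : ℝ, 0 < ε → 0 < δ →
      IsAffine ε δ T u (pa ε δ) (ua ε δ) (Ua ε δ))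
    (a C0 : ℝ) (ha0 : 0 ≤ a) (ha1 : a < 1) (hC0 : 0 < C0)
    (hinit : ∀ ε δ : ℝ, 0 < ε → 0 < δ →
      Real.sqrt (D2L2sq (ua ε δ 0) + ε * D2L2sq (sc (pa ε δ 0))
          + δ * D2L2sq (mtx (Ua ε δ 0)))
        ≤ C0 * (ε + δ) ^ (-a)) :
    ∃ C > (0:ℝ), ∃ η > (0:ℝ), ∀ ε δ : ℝ, 0 < ε → 0 < δ → ε + δ < η →
      ∀ t ∈ Set.Icc (0:ℝ) T,
        ε * L2sq (sc fun x => lapS (pa ε δ t) x)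
            + L2sq (fun x => lapV (ua ε δ t) x)
            + δ * L2sq (mtx fun x i j => lapS (fun y => Ua ε δ t y i j) x)
          ≤ C * (ε + δ) ^ (-(2 * a)) := by
  obtain ⟨M, hM0, hM⟩ := exists_integral_forcingSq_le hNS.smooth_u T
  refine ⟨3 * C0 ^ 2 + M * T, by positivity, 1, one_pos, fun ε δ hε hδ hη t ht => ?_⟩
  have h := hAff ε δ hε hδ
  have hpos : 0 < ε + δ := add_pos hε hδ
  have hone : 1 ≤ (ε + δ) ^ (-(2 * a)) :=
    Real.one_le_rpow_of_pos_of_le_one_of_nonpos hpos hη.le (by linarith)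
  have hsq : (C0 * (ε + δ) ^ (-a)) ^ 2 = C0 ^ 2 * (ε + δ) ^ (-(2 * a)) := by
    rw [mul_pow, ← Real.rpow_mul_natCast hpos.le]
    congr 2
    push_cast
    ring
  have hinit' := (Real.sqrt_le_iff.1 (hinit ε δ hε hδ)).2
  rw [hsq] at hinit'
  have h0 := h.integral_energyDensity_le hε.le hδ.le 0
  have hgrow := integral_cube_le_add_mul h.energyDensity_smooth
    (fun s hs => (h.integral_dtS_energyDensity_le hNS.smooth_u hs).trans (hM s hs)) ht
  rw [← h.integral_energyDensity_eq]
  have hMt : M * t ≤ M * T := mul_le_mul_of_nonneg_left ht.2 hM0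
  have hMT : M * T ≤ M * T * (ε + δ) ^ (-(2 * a)) :=
    le_mul_of_one_le_right (by positivity) hone
  linarith

end NSRelax
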